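/- arXiv:2602.23124 — 2 statements merged into one kernel-verified Lean document; each statement's English description precedes it below -/
import Mathlib

section
/- Let g₁, g₂, … be exchangeable real-valued random variables with tail σ-algebra T*, and suppose that for every ε > 0 both t·P(|g₁| > εt | T*) → 0 and (1/t)·E(g₁²·1_{|g₁| ≤ εt} | T*) → 0 in probability as t → ∞. Then with Δ_N = E(g₁·1_{|g₁| ≤ N} | T*), the conditional probabilities P(|(1/N)·Σ_{n=1}^N g_n − Δ_N| > ε | T*) converge to 0 in probability as N → ∞, for every ε > 0. -/
open MeasureTheory ProbabilityTheory Filter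

/-- The tail σ-algebra T* = ∩_n σ(g_n, g_{n+1}, …) of a sequence of real random
variables. -/
def tailSigma {Ω : Type*} (g : ℕ → Ω → ℝ) : MeasurableSpace Ω :=
  ⨅ n : ℕ, ⨆ m : ℕ, ⨆ _ : n ≤ m, MeasurableSpace.comap (g m) inferInstance

/-- The sequence observed from time `n` on. -/
def shiftedSeq {Ω : Type*} (g : ℕ → Ω → ℝ) (n : ℕ) (ω : Ω) : ℕ → ℝ := fun k => g (n + k) ω

/-- Invariance of the law of a sequence under finitely supported permutations of the indices. -/
def IsExchangeable {Ω : Type*} [MeasurableSpace Ω] (μ : Measure Ω) (g : ℕ → Ω → ℝ) : Prop :=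
  ∀ e : Equiv.Perm ℕ, {n | e n ≠ n}.Finite →
    Measure.map (fun ω => fun n : ℕ => g (e n) ω) μ
      = Measure.map (fun ω => fun n : ℕ => g n ω) μ

lemma exists_finite_perm_eqOn_lt {σ : ℕ → ℕ} (hσ : Function.Injective σ) (N : ℕ) :
    ∃ e : Equiv.Perm ℕ, {n | e n ≠ n}.Finite ∧ ∀ k < N, e k = σ k := by
  induction N with
  | zero => exact ⟨1, by simp, by simp⟩
  | succ N ih =>
    obtain ⟨e, hfin, he⟩ := ih
    refine ⟨Equiv.swap (e N) (σ N) * e, ?_, fun k hk => ?_⟩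
    · refine (hfin.union (Set.toFinite {e N, σ N})).subset fun n hn => ?_
      by_contra hcon
      simp only [Set.mem_union, Set.mem_ofPred_eq, Set.mem_insert_iff, Set.mem_singleton_iff,
        not_or, not_not] at hcon
      apply hn
      rw [Equiv.Perm.mul_apply, hcon.1, Equiv.swap_apply_of_ne_of_ne hcon.2.1 hcon.2.2]
    · rcases Nat.lt_succ_iff_lt_or_eq.1 hk with h | rfl
      · rw [Equiv.Perm.mul_apply, Equiv.swap_apply_of_ne_of_ne, he k h]
        · exact fun h' => h.ne (e.injective h')
        · rw [he k h]
          exact fun h' => h.ne (hσ h')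
      · simp

lemma ProbabilityTheory.IdentDistrib.setIntegral_preimage_eq {Ω E : Type*} [MeasurableSpace Ω]
    [MeasurableSpace E] {μ : Measure Ω} {S S' : Ω → E} (h : IdentDistrib S S' μ μ)
    (hS : Measurable S) (hS' : Measurable S') {D : Set E} (hD : MeasurableSet D)
    {F : E → ℝ} (hF : Measurable F) :
    ∫ ω in S ⁻¹' D, F (S ω) ∂μ = ∫ ω in S' ⁻¹' D, F (S' ω) ∂μ := by
  rw [← integral_indicator (hS hD), ← integral_indicator (hS' hD)]
  exact (h.comp (hF.indicator hD)).integral_eq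

lemma comap_shiftedSeq {Ω : Type*} (g : ℕ → Ω → ℝ) (n : ℕ) :
    MeasurableSpace.comap (shiftedSeq g n) inferInstance
      = ⨆ m : ℕ, ⨆ _ : n ≤ m, MeasurableSpace.comap (g m) inferInstance := by
  have h : MeasurableSpace.comap (shiftedSeq g n) inferInstance
      = ⨆ k : ℕ, MeasurableSpace.comap (g (n + k)) inferInstance := by
    simp only [MeasurableSpace.pi, MeasurableSpace.comap_iSup, MeasurableSpace.comap_comp]
    rfl
  rw [h]
  apply le_antisymm
  · exact iSup_le fun k => le_iSup₂_of_le (n + k) (Nat.le_add_right n k) le_rfl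
  · refine iSup₂_le fun m hm => ?_
    obtain ⟨k, rfl⟩ := Nat.exists_eq_add_of_le hm
    exact le_iSup (fun k => MeasurableSpace.comap (g (n + k)) inferInstance) k

lemma tailSigma_eq_iInf_comap {Ω : Type*} (g : ℕ → Ω → ℝ) :
    tailSigma g = ⨅ n : ℕ, MeasurableSpace.comap (shiftedSeq g n) inferInstance := by
  simp only [comap_shiftedSeq, tailSigma]

lemma tailSigma_le_comap {Ω : Type*} (g : ℕ → Ω → ℝ) (n : ℕ) :
    tailSigma g ≤ MeasurableSpace.comap (shiftedSeq g n) inferInstance := by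
  rw [tailSigma_eq_iInf_comap]
  exact iInf_le _ n

section Exchangeable

variable {Ω : Type*} [m₀ : MeasurableSpace Ω] {μ : Measure Ω} {g : ℕ → Ω → ℝ}

lemma measurable_shiftedSeq (hm : ∀ n, Measurable (g n)) (n : ℕ) : Measurable (shiftedSeq g n) :=
  measurable_pi_lambda _ fun _ => hm _

lemma tailSigma_le (hm : ∀ n, Measurable (g n)) : tailSigma g ≤ m₀ :=
  (tailSigma_le_comap g 0).trans (measurable_shiftedSeq hm 0).comap_le

/-- A function which is measurable with respect to all the shifted σ-algebras up to null sets is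
almost everywhere equal to a tail measurable one. -/
lemma exists_stronglyMeasurable_tailSigma {Z : ℕ → Ω → ℝ}
    (hZ : ∀ n, Measurable[MeasurableSpace.comap (shiftedSeq g n) inferInstance] (Z n))
    {Y : Ω → ℝ} (hY : ∀ᶠ n in atTop, Z n =ᵐ[μ] Y) :
    ∃ W, StronglyMeasurable[tailSigma g] W ∧ W =ᵐ[μ] Y := by
  refine ⟨fun ω => limsup (fun n => Z n ω) atTop, ?_, ?_⟩
  · refine Measurable.stronglyMeasurable ?_
    rw [tailSigma_eq_iInf_comap, measurable_iff_comap_le]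
    refine le_iInf fun n => ?_
    rw [← measurable_iff_comap_le]
    have h : (fun ω => limsup (fun k => Z k ω) atTop)
        = fun ω => limsup (fun k => Z (k + n) ω) atTop := by
      ext ω
      exact (limsup_nat_add (fun k => Z k ω) n).symm
    rw [h]
    refine Measurable.limsup fun k => (hZ (k + n)).mono ?_ le_rfl
    rw [comap_shiftedSeq, comap_shiftedSeq]
    exact iSup₂_le fun m hm => le_iSup₂_of_le m (by omega) le_rfl
  · obtain ⟨N, hN⟩ := eventually_atTop.1 hY
    have h : ∀ᵐ ω ∂μ, ∀ n, N ≤ n → Z n ω = Y ω := by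
      rw [ae_all_iff]
      intro n
      by_cases hn : N ≤ n
      · filter_upwards [hN n hn] with ω hω _ using hω
      · exact Eventually.of_forall fun _ h => absurd h hn
    filter_upwards [h] with ω hω
    have : (fun n => Z n ω) =ᶠ[atTop] fun _ => Y ω := by
      filter_upwards [eventually_ge_atTop N] with n hn using hω n hn
    rw [limsup_congr this, limsup_const]

/-- The law of an exchangeable sequence is invariant under passing to a reordered subsequence. -/
lemma IsExchangeable.identDistrib [IsFiniteMeasure μ] (hex : IsExchangeable μ g)
    (hm : ∀ n, Measurable (g n)) {σ : ℕ → ℕ} (hσ : Function.Injective σ) :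
    IdentDistrib (fun ω k => g (σ k) ω) (fun ω k => g k ω) μ μ := by
  have hmeas : ∀ τ : ℕ → ℕ, Measurable (fun ω k => g (τ k) ω) :=
    fun τ => measurable_pi_lambda _ fun _ => hm _
  refine ⟨(hmeas σ).aemeasurable, (hmeas id).aemeasurable, ?_⟩
  refine IsProjectiveLimit.unique
    (P := fun I : Finset ℕ => (μ.map (fun ω k => g k ω)).map I.restrict) (fun I => ?_) fun I => rfl
  obtain ⟨N, hN⟩ := I.exists_nat_subset_range
  obtain ⟨e, hfin, he⟩ := exists_finite_perm_eqOn_lt hσ N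
  dsimp only
  rw [← hex e hfin, Measure.map_map (Finset.measurable_restrict I) (hmeas σ),
    Measure.map_map (Finset.measurable_restrict I) (hmeas e)]
  congr 1
  ext ω k
  simp [he k (Finset.mem_range.1 (hN k.2))]

/-- Conditional expectations given the tail are invariant under finite permutations. -/
lemma IsExchangeable.condExp_perm [IsFiniteMeasure μ] (hex : IsExchangeable μ g)
    (hm : ∀ n, Measurable (g n)) {e : Equiv.Perm ℕ} (he : {n | e n ≠ n}.Finite)
    {F : (ℕ → ℝ) → ℝ} (hF : Measurable F) (hint : Integrable (fun ω => F fun k => g k ω) μ) :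
    μ[fun ω => F fun k => g (e k) ω | tailSigma g]
      =ᵐ[μ] μ[fun ω => F fun k => g k ω | tailSigma g] := by
  have hid := hex.identDistrib hm e.injective
  have hint' : Integrable (fun ω => F fun k => g (e k) ω) μ :=
    (hid.comp hF).integrable_iff.2 hint
  refine ae_eq_condExp_of_forall_setIntegral_eq (tailSigma_le hm) hint
    (fun s _ _ => integrable_condExp.integrableOn) (fun s hs _ => ?_)
    stronglyMeasurable_condExp.aestronglyMeasurable
  rw [setIntegral_condExp (tailSigma_le hm) hint' hs]
  obtain ⟨M, hM⟩ := he.bddAbove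
  obtain ⟨C, hC, rfl⟩ := tailSigma_le_comap g (M + 1) s hs
  have hC' : MeasurableSet {x : ℕ → ℝ | (fun k => x (M + 1 + k)) ∈ C} :=
    (measurable_pi_lambda (fun (x : ℕ → ℝ) k => x (M + 1 + k)) fun _ => measurable_pi_apply _) hC
  have hfix : ∀ k, e (M + 1 + k) = M + 1 + k := fun k => by
    by_contra hk
    have := hM hk
    omega
  have h := hid.setIntegral_preimage_eq (measurable_pi_lambda _ fun _ => hm _)
    (measurable_pi_lambda _ fun _ => hm _) hC' hF
  simp only [Set.preimage_ofPred_eq, hfix] at h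
  exact h

/-- The conditional expectation of a function of the first variable given the later ones is
tail measurable. -/
lemma IsExchangeable.condExp_comap_ae_eq_condExp_tailSigma [IsFiniteMeasure μ]
    (hex : IsExchangeable μ g) (hm : ∀ n, Measurable (g n)) {f : ℝ → ℝ} (hf : Measurable f)
    (hL2 : MemLp (fun ω => f (g 0 ω)) 2 μ) :
    μ[fun ω => f (g 0 ω) | MeasurableSpace.comap (shiftedSeq g 1) inferInstance]
      =ᵐ[μ] μ[fun ω => f (g 0 ω) | tailSigma g] := by
  set X : Ω → ℝ := fun ω => f (g 0 ω)
  have hX : Integrable X μ := hL2.integrable one_le_two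
  have hle : ∀ n, MeasurableSpace.comap (shiftedSeq g n) inferInstance ≤ m₀ :=
    fun n => (measurable_shiftedSeq hm n).comap_le
  obtain ⟨φ, hφ, hφeq⟩ := (stronglyMeasurable_condExp (μ := μ) (f := X)
    (m := MeasurableSpace.comap (shiftedSeq g 1) inferInstance)).exists_eq_measurable_comp
  replace hφ : Measurable φ := hφ.measurable
  have hidS : ∀ n, IdentDistrib (shiftedSeq g n) (shiftedSeq g 0) μ μ := fun n => by
    have h := hex.identDistrib hm (add_right_injective n)
    have h0 : shiftedSeq g 0 = fun ω k => g k ω := by simp [shiftedSeq, funext_iff]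
    rw [h0]
    exact h
  have hid1 : ∀ n, IdentDistrib (shiftedSeq g n) (shiftedSeq g 1) μ μ :=
    fun n => (hidS n).trans (hidS 1).symm
  have hZ2 : ∀ n, MemLp (φ ∘ shiftedSeq g n) 2 μ := fun n => by
    rw [((hid1 n).comp hφ).memLp_iff, ← hφeq]
    exact hL2.condExp one_le_two
  have hZint : ∀ n, Integrable (φ ∘ shiftedSeq g n) μ := fun n => (hZ2 n).integrable one_le_two
  have hpair : ∀ n, 1 ≤ n → ∀ C : Set (ℕ → ℝ), MeasurableSet C →
      ∫ ω in shiftedSeq g n ⁻¹' C, X ω ∂μ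
        = ∫ ω in {ω | (fun k => g (k + 1) ω) ∈ C}, X ω ∂μ := by
    intro n hn C hC
    have hinj : Function.Injective (fun k : ℕ => if k = 0 then 0 else n + (k - 1)) := by
      intro a b hab
      dsimp only at hab
      split_ifs at hab <;> omega
    have hC' : MeasurableSet {x : ℕ → ℝ | (fun k => x (k + 1)) ∈ C} :=
      (measurable_pi_lambda (fun (x : ℕ → ℝ) k => x (k + 1)) fun _ => measurable_pi_apply _) hC
    have h := (hex.identDistrib hm hinj).setIntegral_preimage_eq
      (measurable_pi_lambda _ fun _ => hm _) (measurable_pi_lambda _ fun _ => hm _) hC'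
      (hf.comp (measurable_pi_apply (X := fun _ : ℕ => ℝ) 0))
    simp only [Set.preimage_ofPred_eq, Nat.add_eq_zero_iff, one_ne_zero, and_false, if_false,
      Nat.add_sub_cancel] at h
    exact h
  have hcond : ∀ n, 1 ≤ n → φ ∘ shiftedSeq g n
      =ᵐ[μ] μ[X | MeasurableSpace.comap (shiftedSeq g n) inferInstance] := by
    intro n hn
    refine ae_eq_condExp_of_forall_setIntegral_eq (hle n) hX
      (fun s _ _ => (hZint n).integrableOn) (fun s hs _ => ?_)
      (hφ.comp (comap_measurable _)).stronglyMeasurable.aestronglyMeasurable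
    obtain ⟨C, hC, rfl⟩ := hs
    rw [hpair n hn C hC, ← hpair 1 le_rfl C hC, ← setIntegral_condExp (hle 1) hX ⟨C, hC, rfl⟩,
      hφeq]
    exact (hid1 n).setIntegral_preimage_eq (measurable_shiftedSeq hm n)
      (measurable_shiftedSeq hm 1) hC hφ
  have hsame : ∀ n, 1 ≤ n → φ ∘ shiftedSeq g n =ᵐ[μ] φ ∘ shiftedSeq g 1 := by
    intro n hn
    have hmono : MeasurableSpace.comap (shiftedSeq g n) inferInstance
        ≤ MeasurableSpace.comap (shiftedSeq g 1) inferInstance := by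
      rw [comap_shiftedSeq, comap_shiftedSeq]
      exact iSup₂_le fun m hm => le_iSup₂_of_le m (by omega) le_rfl
    have hproj : μ[φ ∘ shiftedSeq g 1 | MeasurableSpace.comap (shiftedSeq g n) inferInstance]
        =ᵐ[μ] φ ∘ shiftedSeq g n := by
      rw [← hφeq]
      exact (condExp_condExp_of_le hmono (hle 1)).trans (hcond n hn).symm
    have hprod : Integrable (φ ∘ shiftedSeq g n * φ ∘ shiftedSeq g 1) μ :=
      (hZ2 n).integrable_mul (hZ2 1)
    have hcross : ∫ ω, (φ ∘ shiftedSeq g n * φ ∘ shiftedSeq g 1) ω ∂μ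
        = ∫ ω, (φ ∘ shiftedSeq g n) ω ^ 2 ∂μ := by
      rw [← integral_condExp (hle n)]
      refine integral_congr_ae ?_
      filter_upwards [hproj, condExp_mul_of_stronglyMeasurable_left
        (hφ.comp (comap_measurable (shiftedSeq g n))).stronglyMeasurable hprod (hZint 1)]
        with ω h1 h2
      rw [h2, Pi.mul_apply, h1, sq]
    have hsq : ∫ ω, (φ ∘ shiftedSeq g n) ω ^ 2 ∂μ = ∫ ω, (φ ∘ shiftedSeq g 1) ω ^ 2 ∂μ :=
      ((hid1 n).comp (hφ.pow_const 2)).integral_eq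
    have hzero : ∫ ω, ((φ ∘ shiftedSeq g n) ω - (φ ∘ shiftedSeq g 1) ω) ^ 2 ∂μ = 0 := by
      have h : ∀ ω, ((φ ∘ shiftedSeq g n) ω - (φ ∘ shiftedSeq g 1) ω) ^ 2
          = (φ ∘ shiftedSeq g n) ω ^ 2 + (φ ∘ shiftedSeq g 1) ω ^ 2
            - 2 * (φ ∘ shiftedSeq g n * φ ∘ shiftedSeq g 1) ω := fun ω => by
        rw [Pi.mul_apply]; ring
      have hsum : Integrable (fun ω => (φ ∘ shiftedSeq g n) ω ^ 2 + (φ ∘ shiftedSeq g 1) ω ^ 2) μ :=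
        (hZ2 n).integrable_sq.add (hZ2 1).integrable_sq
      simp_rw [h]
      rw [integral_sub hsum (hprod.const_mul 2),
        integral_add (hZ2 n).integrable_sq (hZ2 1).integrable_sq, integral_const_mul, hcross, hsq]
      ring
    have hzero' := (integral_eq_zero_iff_of_nonneg (fun ω => sq_nonneg _)
      ((hZ2 n).sub (hZ2 1)).integrable_sq).1 hzero
    filter_upwards [hzero'] with ω hω
    exact sub_eq_zero.1 (pow_eq_zero_iff two_ne_zero |>.1 hω)
  obtain ⟨W, hW, hWeq⟩ := exists_stronglyMeasurable_tailSigma (μ := μ) (g := g)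
    (Z := fun n => φ ∘ shiftedSeq g n) (fun n => hφ.comp (comap_measurable _))
    (eventually_atTop.2 ⟨1, hsame⟩)
  rw [← hφeq] at hWeq
  have h1 : μ[W | tailSigma g] =ᵐ[μ] μ[X | tailSigma g] :=
    (condExp_congr_ae hWeq).trans (condExp_condExp_of_le (tailSigma_le_comap g 1) (hle 1))
  rw [condExp_of_stronglyMeasurable (tailSigma_le hm) hW (integrable_condExp.congr hWeq.symm)] at h1
  exact hWeq.symm.trans h1

lemma IsExchangeable.identDistrib_apply [IsFiniteMeasure μ] (hex : IsExchangeable μ g)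
    (hm : ∀ n, Measurable (g n)) (n : ℕ) : IdentDistrib (g n) (g 0) μ μ := by
  have h := (hex.identDistrib hm (add_right_injective n)).comp
    (measurable_pi_apply (X := fun _ : ℕ => ℝ) 0)
  exact h

lemma IsExchangeable.condExp_apply [IsFiniteMeasure μ] (hex : IsExchangeable μ g)
    (hm : ∀ n, Measurable (g n)) {f : ℝ → ℝ} (hf : Measurable f)
    (hint : Integrable (fun ω => f (g 0 ω)) μ) (n : ℕ) :
    μ[fun ω => f (g n ω) | tailSigma g] =ᵐ[μ] μ[fun ω => f (g 0 ω) | tailSigma g] := by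
  obtain ⟨e, hfin, he⟩ := exists_finite_perm_eqOn_lt (add_right_injective n) 1
  have h := hex.condExp_perm hm hfin
    (hf.comp (measurable_pi_apply (X := fun _ : ℕ => ℝ) 0)) hint
  simpa [he 0 one_pos] using h

/-- Distinct terms of an exchangeable sequence are conditionally uncorrelated given the tail. -/
lemma IsExchangeable.condExp_mul [IsFiniteMeasure μ] (hex : IsExchangeable μ g)
    (hm : ∀ n, Measurable (g n)) {f : ℝ → ℝ} (hf : Measurable f)
    (hL2 : MemLp (fun ω => f (g 0 ω)) 2 μ) {n m : ℕ} (hnm : n ≠ m) :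
    μ[fun ω => f (g n ω) * f (g m ω) | tailSigma g]
      =ᵐ[μ] fun ω => (μ[fun ω => f (g 0 ω) | tailSigma g]) ω ^ 2 := by
  have hL2' : ∀ k, MemLp (fun ω => f (g k ω)) 2 μ := fun k =>
    ((hex.identDistrib_apply hm k).comp hf).memLp_iff.2 hL2
  have hinj : Function.Injective
      (fun k : ℕ => if k = 0 then n else if k = 1 then m else n + m + k) := by
    intro a b hab
    dsimp only at hab
    split_ifs at hab <;> omega
  obtain ⟨e, hfin, he⟩ := exists_finite_perm_eqOn_lt hinj 2
  have he0 : e 0 = n := by simpa using he 0 two_pos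
  have he1 : e 1 = m := by simpa using he 1 one_lt_two
  have h01 : Integrable ((fun ω => f (g 0 ω)) * fun ω => f (g 1 ω)) μ :=
    (hL2' 0).integrable_mul (hL2' 1)
  have hred := hex.condExp_perm hm hfin (F := fun x => f (x 0) * f (x 1))
    ((hf.comp (measurable_pi_apply 0)).mul (hf.comp (measurable_pi_apply 1))) h01
  simp only [he0, he1] at hred
  refine hred.trans ?_
  have hle := (measurable_shiftedSeq hm 1).comap_le
  have hmeas1 : StronglyMeasurable[MeasurableSpace.comap (shiftedSeq g 1) inferInstance]
      (fun ω => f (g 1 ω)) :=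
    (hf.comp ((measurable_pi_apply (X := fun _ : ℕ => ℝ) 0).comp
      (comap_measurable (shiftedSeq g 1)))).stronglyMeasurable
  have hDint : Integrable (μ[fun ω => f (g 0 ω) | tailSigma g] * fun ω => f (g 1 ω)) μ :=
    (hL2.condExp one_le_two).integrable_mul (hL2' 1)
  have hstep : μ[(fun ω => f (g 0 ω)) * fun ω => f (g 1 ω) |
      MeasurableSpace.comap (shiftedSeq g 1) inferInstance]
      =ᵐ[μ] μ[fun ω => f (g 0 ω) | tailSigma g] * fun ω => f (g 1 ω) :=
    (condExp_mul_of_stronglyMeasurable_right hmeas1 h01 (hL2.integrable one_le_two)).trans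
      ((hex.condExp_comap_ae_eq_condExp_tailSigma hm hf hL2).mul EventuallyEq.rfl)
  have htower := (condExp_condExp_of_le (μ := μ) (f := (fun ω => f (g 0 ω)) * fun ω => f (g 1 ω))
    (tailSigma_le_comap g 1) hle).symm.trans (condExp_congr_ae hstep)
  refine htower.trans ?_
  filter_upwards [condExp_mul_of_stronglyMeasurable_left stronglyMeasurable_condExp hDint
    ((hL2' 1).integrable one_le_two), hex.condExp_apply hm hf (hL2.integrable one_le_two) 1]
    with ω h1 h2
  rw [h1, Pi.mul_apply, h2, sq]

/-- Conditionally on the tail, the variance of an average of `N` terms is at most the second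
moment of a single term divided by `N`. -/
lemma IsExchangeable.condExp_average_sub_sq_le [IsFiniteMeasure μ] (hex : IsExchangeable μ g)
    (hm : ∀ n, Measurable (g n)) {f : ℝ → ℝ} (hf : Measurable f)
    (hL2 : MemLp (fun ω => f (g 0 ω)) 2 μ) {N : ℕ} (hN : N ≠ 0) :
    μ[fun ω => ((N : ℝ)⁻¹ * ∑ n ∈ Finset.range N, f (g n ω)
        - (μ[fun ω => f (g 0 ω) | tailSigma g]) ω) ^ 2 | tailSigma g]
      ≤ᵐ[μ] fun ω => (N : ℝ)⁻¹ * (μ[fun ω => f (g 0 ω) ^ 2 | tailSigma g]) ω := by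
  set D := μ[fun ω => f (g 0 ω) | tailSigma g]
  have hL2' : ∀ k, MemLp (fun ω => f (g k ω)) 2 μ := fun k =>
    ((hex.identDistrib_apply hm k).comp hf).memLp_iff.2 hL2
  have hDL2 : MemLp D 2 μ := hL2.condExp one_le_two
  have hN' : (N : ℝ) ≠ 0 := Nat.cast_ne_zero.2 hN
  have hcov : ∀ n m : ℕ, μ[fun ω => (f (g n ω) - D ω) * (f (g m ω) - D ω) | tailSigma g]
      ≤ᵐ[μ] fun ω => if n = m then (μ[fun ω => f (g 0 ω) ^ 2 | tailSigma g]) ω else 0 := by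
    intro n m
    have hdecomp : (fun ω => (f (g n ω) - D ω) * (f (g m ω) - D ω))
        = (fun ω => f (g n ω) * f (g m ω)) - D * (fun ω => f (g n ω))
          - D * (fun ω => f (g m ω)) + D * D := by
      ext ω
      simp only [Pi.add_apply, Pi.sub_apply, Pi.mul_apply]
      ring
    have hi1 : Integrable (fun ω => f (g n ω) * f (g m ω)) μ := (hL2' n).integrable_mul (hL2' m)
    have hi2 : ∀ k, Integrable (D * fun ω => f (g k ω)) μ := fun k => hDL2.integrable_mul (hL2' k)
    have hi3 : Integrable (D * D) μ := hDL2.integrable_mul hDL2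
    have hpull : ∀ k, μ[D * fun ω => f (g k ω) | tailSigma g] =ᵐ[μ] D * D := fun k =>
      (condExp_mul_of_stronglyMeasurable_left stronglyMeasurable_condExp (hi2 k)
        ((hL2' k).integrable one_le_two)).trans
        (EventuallyEq.rfl.mul (hex.condExp_apply hm hf (hL2.integrable one_le_two) k))
    have hDD : μ[D * D | tailSigma g] = D * D :=
      condExp_of_stronglyMeasurable (tailSigma_le hm)
        (stronglyMeasurable_condExp.mul stronglyMeasurable_condExp) hi3
    have hprod : μ[fun ω => f (g n ω) * f (g m ω) | tailSigma g] ≤ᵐ[μ] fun ω =>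
        (if n = m then (μ[fun ω => f (g 0 ω) ^ 2 | tailSigma g]) ω else 0) + D ω * D ω := by
      split_ifs with h
      · subst h
        have h := hex.condExp_apply hm (hf.pow_const 2) hL2.integrable_sq n
        simp only [← sq]
        filter_upwards [h] with ω hω
        rw [hω]
        exact le_add_of_nonneg_right (sq_nonneg _)
      · filter_upwards [hex.condExp_mul hm hf hL2 h] with ω hω
        rw [hω, zero_add, sq]
    rw [hdecomp]
    filter_upwards [condExp_add ((hi1.sub (hi2 n)).sub (hi2 m)) hi3 (tailSigma g),
      condExp_sub (hi1.sub (hi2 n)) (hi2 m) (tailSigma g), condExp_sub hi1 (hi2 n) (tailSigma g),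
      hpull n, hpull m, hprod] with ω h1 h2 h3 h4 h5 h6
    rw [h1, Pi.add_apply, h2, Pi.sub_apply, h3, Pi.sub_apply, h4, h5, hDD, Pi.mul_apply]
    linarith
  have hcint : ∀ p : ℕ × ℕ, Integrable (fun ω => (f (g p.1 ω) - D ω) * (f (g p.2 ω) - D ω)) μ :=
    fun p => ((hL2' p.1).sub hDL2).integrable_mul ((hL2' p.2).sub hDL2)
  have hexpand : (fun ω => ((N : ℝ)⁻¹ * ∑ n ∈ Finset.range N, f (g n ω) - D ω) ^ 2)
      = ((N : ℝ)⁻¹ ^ 2) • ∑ p ∈ Finset.range N ×ˢ Finset.range N,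
        fun ω => (f (g p.1 ω) - D ω) * (f (g p.2 ω) - D ω) := by
    ext ω
    have h1 : (N : ℝ)⁻¹ * ∑ n ∈ Finset.range N, f (g n ω) - D ω
        = (N : ℝ)⁻¹ * ∑ n ∈ Finset.range N, (f (g n ω) - D ω) := by
      rw [Finset.sum_sub_distrib, Finset.sum_const, Finset.card_range, nsmul_eq_mul]
      field_simp
    rw [h1, mul_pow, sq (∑ n ∈ Finset.range N, _), Finset.sum_mul_sum, ← Finset.sum_product']
    simp [Finset.sum_apply]
  rw [hexpand]
  have hall : ∀ᵐ ω ∂μ, ∀ p : ℕ × ℕ,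
      (μ[fun ω => (f (g p.1 ω) - D ω) * (f (g p.2 ω) - D ω) | tailSigma g]) ω
        ≤ if p.1 = p.2 then (μ[fun ω => f (g 0 ω) ^ 2 | tailSigma g]) ω else 0 :=
    ae_all_iff.2 fun p => hcov p.1 p.2
  filter_upwards [hall, condExp_smul ((N : ℝ)⁻¹ ^ 2) (∑ p ∈ Finset.range N ×ˢ Finset.range N,
      fun ω => (f (g p.1 ω) - D ω) * (f (g p.2 ω) - D ω)) (tailSigma g) (μ := μ),
    condExp_finsetSum (μ := μ) (s := Finset.range N ×ˢ Finset.range N)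
      (fun p _ => hcint p) (tailSigma g)] with ω h1 h2 h3
  rw [h2, Pi.smul_apply, h3, Finset.sum_apply, smul_eq_mul]
  calc (N : ℝ)⁻¹ ^ 2 * ∑ p ∈ Finset.range N ×ˢ Finset.range N,
        (μ[fun ω => (f (g p.1 ω) - D ω) * (f (g p.2 ω) - D ω) | tailSigma g]) ω
      ≤ (N : ℝ)⁻¹ ^ 2 * ∑ p ∈ Finset.range N ×ˢ Finset.range N,
        if p.1 = p.2 then (μ[fun ω => f (g 0 ω) ^ 2 | tailSigma g]) ω else 0 := by
        gcongr with p _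
        exact h1 p
    _ = (N : ℝ)⁻¹ * (μ[fun ω => f (g 0 ω) ^ 2 | tailSigma g]) ω := by
        rw [Finset.sum_product]
        simp only [Finset.sum_ite_eq, Finset.mem_range]
        rw [Finset.sum_congr rfl fun n hn => if_pos (Finset.mem_range.1 hn), Finset.sum_const,
          Finset.card_range, nsmul_eq_mul]
        field_simp

/-- The conditional Chebyshev-type bound for averages of an exchangeable sequence, obtained by
truncating at level `N`. -/
lemma IsExchangeable.condExp_indicator_average_le [IsFiniteMeasure μ] (hex : IsExchangeable μ g)
    (hm : ∀ n, Measurable (g n)) {N : ℕ} (hN : N ≠ 0) {ε : ℝ} (hε : 0 < ε) {D : Ω → ℝ}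
    (hD : D = μ[fun ω => g 0 ω *
        Set.indicator {ω' | |g 0 ω'| ≤ (N : ℝ)} (fun _ => (1 : ℝ)) ω | tailSigma g]) :
    μ[Set.indicator {ω' | ε < |(N : ℝ)⁻¹ * ∑ n ∈ Finset.range N, g n ω' - D ω'|}
        (fun _ => (1 : ℝ)) | tailSigma g]
      ≤ᵐ[μ] fun ω =>
        N * (μ[Set.indicator {ω' | 1 * (N : ℝ) < |g 0 ω'|} (fun _ => (1 : ℝ)) | tailSigma g]) ω
        + (ε⁻¹ ^ 2) * ((N : ℝ)⁻¹ * (μ[fun ω' => (g 0 ω') ^ 2 *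
            Set.indicator {ω'' | |g 0 ω''| ≤ 1 * (N : ℝ)} (fun _ => (1 : ℝ)) ω' | tailSigma g]) ω)
        := by
  set f : ℝ → ℝ := {x : ℝ | |x| ≤ N}.indicator id with hf_def
  set q : ℝ → ℝ := {x : ℝ | 1 * (N : ℝ) < |x|}.indicator fun _ => 1 with hq_def
  have hf : Measurable f :=
    measurable_id.indicator (measurableSet_le measurable_norm measurable_const)
  have hq : Measurable q :=
    measurable_const.indicator (measurableSet_lt measurable_const measurable_norm)
  have hfL2 : MemLp (fun ω => f (g 0 ω)) 2 μ := by
    refine MemLp.of_bound (hf.comp (hm 0)).aestronglyMeasurable N (Eventually.of_forall fun ω => ?_)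
    simp only [hf_def, Set.indicator_apply, Set.mem_ofPred_eq]
    split_ifs with h
    · exact h
    · simp
  have hqint : ∀ n, Integrable (fun ω => q (g n ω)) μ := fun n =>
    (integrable_const (1 : ℝ)).indicator (measurableSet_lt measurable_const (hm n).norm)
  have hfg : (fun ω => g 0 ω * Set.indicator {ω' | |g 0 ω'| ≤ (N : ℝ)} (fun _ => (1 : ℝ)) ω)
      = fun ω => f (g 0 ω) := by
    ext ω
    simp [hf_def, Set.indicator_apply]
  have hfg2 : (fun ω' => (g 0 ω') ^ 2 *
      Set.indicator {ω'' | |g 0 ω''| ≤ 1 * (N : ℝ)} (fun _ => (1 : ℝ)) ω')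
      = fun ω => f (g 0 ω) ^ 2 := by
    ext ω
    simp only [hf_def, Set.indicator_apply, Set.mem_ofPred_eq, one_mul]
    split_ifs <;> simp
  have hqg : Set.indicator {ω' | 1 * (N : ℝ) < |g 0 ω'|} (fun _ => (1 : ℝ))
      = fun ω => q (g 0 ω) := rfl
  rw [hfg] at hD
  rw [hfg2, hqg]
  have hDm : Measurable D := by
    rw [hD]
    exact (stronglyMeasurable_condExp.mono (tailSigma_le hm)).measurable
  have hDL2 : MemLp D 2 μ := by
    rw [hD]
    exact hfL2.condExp one_le_two
  have hfL2' : ∀ k, MemLp (fun ω => f (g k ω)) 2 μ := fun k =>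
    ((hex.identDistrib_apply hm k).comp hf).memLp_iff.2 hfL2
  set V : Ω → ℝ := fun ω => ((N : ℝ)⁻¹ * ∑ n ∈ Finset.range N, f (g n ω) - D ω) ^ 2 with hV
  have hVint : Integrable V μ :=
    (((memLp_finsetSum (Finset.range N) fun n _ => hfL2' n).const_mul (N : ℝ)⁻¹).sub
      hDL2).integrable_sq
  have hQint : Integrable (∑ n ∈ Finset.range N, fun ω => q (g n ω)) μ :=
    integrable_finsetSum' _ fun n _ => hqint n
  have hAint : Integrable (Set.indicator
      {ω' | ε < |(N : ℝ)⁻¹ * ∑ n ∈ Finset.range N, g n ω' - D ω'|} (fun _ => (1 : ℝ))) μ := by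
    refine (integrable_const (1 : ℝ)).indicator (measurableSet_lt measurable_const ?_)
    exact (((Finset.measurable_fun_sum _ fun n _ => hm n).const_mul _).sub hDm).norm
  have hqnonneg : ∀ x, 0 ≤ q x := fun x => Set.indicator_nonneg (fun _ _ => zero_le_one) x
  have hpt : Set.indicator {ω' | ε < |(N : ℝ)⁻¹ * ∑ n ∈ Finset.range N, g n ω' - D ω'|}
      (fun _ => (1 : ℝ)) ≤ (∑ n ∈ Finset.range N, fun ω => q (g n ω)) + (ε⁻¹ ^ 2) • V := by
    intro ω
    simp only [Pi.add_apply, Finset.sum_apply, Pi.smul_apply, smul_eq_mul]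
    refine Set.indicator_le' (f := fun _ => (1 : ℝ))
      (g := fun ω => ∑ n ∈ Finset.range N, q (g n ω) + ε⁻¹ ^ 2 * V ω) (fun ω hω => ?_)
      (fun ω _ => add_nonneg (Finset.sum_nonneg fun n _ => hqnonneg _)
        (mul_nonneg (sq_nonneg _) (sq_nonneg _))) ω
    have hV0 : 0 ≤ ε⁻¹ ^ 2 * V ω := mul_nonneg (sq_nonneg _) (sq_nonneg _)
    by_cases hbig : ∃ n ∈ Finset.range N, (N : ℝ) < |g n ω|
    · obtain ⟨n, hn, hlt⟩ := hbig
      have h1 : q (g n ω) = 1 := Set.indicator_of_mem (by simpa using hlt) _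
      have h2 := Finset.single_le_sum (f := fun n => q (g n ω)) (fun k _ => hqnonneg _) hn
      linarith
    · push Not at hbig
      have hsum : ∑ n ∈ Finset.range N, f (g n ω) = ∑ n ∈ Finset.range N, g n ω :=
        Finset.sum_congr rfl fun n hn => Set.indicator_of_mem
          (show g n ω ∈ {x : ℝ | |x| ≤ N} from hbig n hn) _
      have hlt : ε ^ 2 < V ω := by
        simp only [hV]
        rw [hsum, ← sq_abs (_ - _)]
        exact pow_lt_pow_left₀ hω hε.le two_ne_zero
      have h1 : 1 ≤ ε⁻¹ ^ 2 * V ω := by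
        rw [inv_pow, inv_mul_eq_div, one_le_div (by positivity)]
        exact hlt.le
      have hQ0 : 0 ≤ ∑ n ∈ Finset.range N, q (g n ω) := Finset.sum_nonneg fun n _ => hqnonneg _
      linarith
  have hall : ∀ᵐ ω ∂μ, ∀ n, (μ[fun ω => q (g n ω) | tailSigma g]) ω
      = (μ[fun ω => q (g 0 ω) | tailSigma g]) ω :=
    ae_all_iff.2 fun n => hex.condExp_apply hm hq (hqint 0) n
  have hvar := hex.condExp_average_sub_sq_le hm hf hfL2 hN
  rw [← hD] at hvar
  filter_upwards [condExp_mono (m := tailSigma g) hAint (hQint.add (hVint.smul (ε⁻¹ ^ 2)))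
      (Eventually.of_forall hpt), hall, hvar,
    condExp_add hQint (hVint.smul (ε⁻¹ ^ 2)) (tailSigma g),
    condExp_smul (μ := μ) (ε⁻¹ ^ 2) V (tailSigma g),
    condExp_finsetSum (μ := μ) (s := Finset.range N) (fun n _ => hqint n) (tailSigma g)]
    with ω h1 h2 h3 h4 h5 h6
  refine h1.trans ?_
  rw [h4, Pi.add_apply, h5, Pi.smul_apply, h6, Finset.sum_apply, smul_eq_mul,
    Finset.sum_congr rfl fun n _ => h2 n, Finset.sum_const, Finset.card_range, nsmul_eq_mul]
  gcongr

end Exchangeable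

/-- A sequence which is nonnegative and eventually dominated by a combination of two sequences
tending to zero in measure tends to zero in measure. -/
lemma tendstoInMeasure_zero_of_le_add_mul {Ω ι : Type*} [MeasurableSpace Ω] {μ : Measure Ω}
    {l : Filter ι} {u v w : ι → Ω → ℝ} {c : ℝ} (hc : 0 < c) (hv : TendstoInMeasure μ v l 0)
    (hw : TendstoInMeasure μ w l 0) (hu : ∀ i, 0 ≤ᵐ[μ] u i)
    (h : ∀ᶠ i in l, u i ≤ᵐ[μ] fun ω => v i ω + c * w i ω) : TendstoInMeasure μ u l 0 := by
  rw [tendstoInMeasure_iff_norm] at hv hw ⊢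
  intro δ hδ
  have hsum := (hv (δ / 2) (half_pos hδ)).add (hw (δ / 2 / c) (by positivity))
  rw [add_zero] at hsum
  refine tendsto_of_tendsto_of_tendsto_of_le_of_le' tendsto_const_nhds hsum
    (Eventually.of_forall fun _ => zero_le) ?_
  filter_upwards [h] with i hi
  refine (measure_mono_ae ?_).trans (measure_union_le _ _)
  filter_upwards [hi, hu i] with ω h1 h2 h3
  change δ ≤ ‖u i ω - 0‖ at h3
  change δ / 2 ≤ ‖v i ω - 0‖ ∨ δ / 2 / c ≤ ‖w i ω - 0‖
  simp only [sub_zero, Real.norm_eq_abs] at h3 ⊢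
  rw [abs_of_nonneg h2] at h3
  by_contra! hcon
  obtain ⟨h4, h5⟩ := hcon
  rw [lt_div_iff₀ hc] at h5
  nlinarith [le_abs_self (v i ω), le_abs_self (w i ω)]

/-- Sufficiency in the conditional WLLN for exchangeable sequences: if for every ε > 0
both t·P(|g₁| > εt | T*) → 0 and (1/t)·E(g₁²·1_{|g₁| ≤ εt} | T*) → 0 in probability as
t → ∞, then with Δ_N = E(g₁·1_{|g₁| ≤ N} | T*) the conditional probabilities
P(|(1/N)·Σ_{n=1}^N g_n − Δ_N| > ε | T*) tend to 0 in probability, for every ε > 0. -/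
theorem stmt_18 {Ω : Type*} [MeasurableSpace Ω] (μ : Measure Ω) [IsProbabilityMeasure μ]
    (g : ℕ → Ω → ℝ) (hm : ∀ n, Measurable (g n))
    (hexch : ∀ e : Equiv.Perm ℕ, {n | e n ≠ n}.Finite →
      Measure.map (fun ω => fun n : ℕ => g (e n) ω) μ
        = Measure.map (fun ω => fun n : ℕ => g n ω) μ)
    (hT : ∀ ε > (0:ℝ), TendstoInMeasure μ
      (fun (t : ℝ) (ω : Ω) =>
        t * (μ[Set.indicator {ω' | ε * t < |g 0 ω'|} (fun _ => (1:ℝ)) | tailSigma g]) ω)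
      atTop 0)
    (hSig : ∀ ε > (0:ℝ), TendstoInMeasure μ
      (fun (t : ℝ) (ω : Ω) =>
        t⁻¹ * (μ[fun ω' => (g 0 ω') ^ 2 *
            Set.indicator {ω'' | |g 0 ω''| ≤ ε * t} (fun _ => (1:ℝ)) ω' | tailSigma g]) ω)
      atTop 0)
    (Δ : ℕ → Ω → ℝ)
    (hΔ : ∀ N : ℕ, Δ N = μ[fun ω => g 0 ω *
        Set.indicator {ω' | |g 0 ω'| ≤ (N : ℝ)} (fun _ => (1:ℝ)) ω | tailSigma g]) :
    ∀ ε > (0:ℝ), TendstoInMeasure μ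
      (fun (N : ℕ) (ω : Ω) =>
        (μ[Set.indicator
            {ω' | ε < |(N : ℝ)⁻¹ * ∑ n ∈ Finset.range N, g n ω' - Δ N ω'|}
            (fun _ => (1:ℝ)) | tailSigma g]) ω)
      atTop 0 := by
  intro ε hε
  refine tendstoInMeasure_zero_of_le_add_mul (c := ε⁻¹ ^ 2) (by positivity)
    ((hT 1 one_pos).comp tendsto_natCast_atTop_atTop)
    ((hSig 1 one_pos).comp tendsto_natCast_atTop_atTop) (fun N => ?_) ?_
  · exact condExp_nonneg
      (Eventually.of_forall fun ω => Set.indicator_nonneg (fun _ _ => zero_le_one) ω)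
  · filter_upwards [eventually_ne_atTop 0] with N hN
    have hex : IsExchangeable μ g := hexch
    exact hex.condExp_indicator_average_le hm hN hε (hΔ N)
end

section
/- Let g₁, g₂, … be exchangeable with tail σ-algebra T*, and suppose for some T*-measurable correctors D_N with |D_N| ≤ N a.s., P(|(1/N)·Σ_{n=1}^N g_n − D_N| > ε) → 0 for all ε > 0. Then D_N/√N → 0 in probability as N → ∞. -/
open MeasureTheory ProbabilityTheory Filter

theorem sum_powerset_signed_sq (a : ℕ → ℝ) (n : ℕ) :
    ∑ t ∈ (Finset.range n).powerset, (∑ i ∈ Finset.range n, if i ∈ t then -a i else a i) ^ 2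
      = 2 ^ n * ∑ i ∈ Finset.range n, a i ^ 2 := by
  induction n with
  | zero => simp
  | succ n ih =>
    have key : ∀ t ∈ (Finset.range n).powerset,
        (∑ i ∈ Finset.range (n + 1), if i ∈ t then -a i else a i) ^ 2
          + (∑ i ∈ Finset.range (n + 1), if i ∈ insert n t then -a i else a i) ^ 2
        = 2 * (∑ i ∈ Finset.range n, if i ∈ t then -a i else a i) ^ 2 + 2 * a n ^ 2 := by
      intro t ht
      have hn : n ∉ t := fun h => by simpa using Finset.mem_powerset.1 ht h
      have h2 : (∑ i ∈ Finset.range n, if i ∈ insert n t then -a i else a i)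
          = ∑ i ∈ Finset.range n, if i ∈ t then -a i else a i := by
        refine Finset.sum_congr rfl fun i hi => ?_
        have : i ≠ n := (Finset.mem_range.1 hi).ne
        simp [this]
      rw [Finset.sum_range_succ, Finset.sum_range_succ, h2]
      simp [hn]
      ring
    rw [Finset.range_add_one, Finset.sum_powerset_insert (by simp), ← Finset.sum_add_distrib,
      ← Finset.range_add_one, Finset.sum_congr rfl key, Finset.sum_add_distrib, ← Finset.mul_sum,
      ih, Finset.sum_range_succ]
    simp
    ring

theorem sum_powerset_signed_pow_four_le (a : ℕ → ℝ) (n : ℕ) :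
    ∑ t ∈ (Finset.range n).powerset, (∑ i ∈ Finset.range n, if i ∈ t then -a i else a i) ^ 4
      ≤ 3 * 2 ^ n * (∑ i ∈ Finset.range n, a i ^ 2) ^ 2 := by
  induction n with
  | zero => simp
  | succ n ih =>
    have key : ∀ t ∈ (Finset.range n).powerset,
        (∑ i ∈ Finset.range (n + 1), if i ∈ t then -a i else a i) ^ 4
          + (∑ i ∈ Finset.range (n + 1), if i ∈ insert n t then -a i else a i) ^ 4
        = 2 * (∑ i ∈ Finset.range n, if i ∈ t then -a i else a i) ^ 4
          + 12 * a n ^ 2 * (∑ i ∈ Finset.range n, if i ∈ t then -a i else a i) ^ 2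
          + 2 * a n ^ 4 := by
      intro t ht
      have hn : n ∉ t := fun h => by simpa using Finset.mem_powerset.1 ht h
      have h2 : (∑ i ∈ Finset.range n, if i ∈ insert n t then -a i else a i)
          = ∑ i ∈ Finset.range n, if i ∈ t then -a i else a i := by
        refine Finset.sum_congr rfl fun i hi => ?_
        have : i ≠ n := (Finset.mem_range.1 hi).ne
        simp [this]
      rw [Finset.sum_range_succ, Finset.sum_range_succ, h2]
      simp [hn]
      ring
    rw [Finset.range_add_one, Finset.sum_powerset_insert (by simp), ← Finset.sum_add_distrib,
      ← Finset.range_add_one, Finset.sum_congr rfl key, Finset.sum_add_distrib,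
      Finset.sum_add_distrib, ← Finset.mul_sum, ← Finset.mul_sum, sum_powerset_signed_sq,
      Finset.sum_range_succ]
    simp only [Finset.sum_const, Finset.card_powerset, Finset.card_range, nsmul_eq_mul]
    push_cast
    have : (0 : ℝ) ≤ 2 ^ n * a n ^ 4 := by positivity
    rw [pow_succ (2 : ℝ) n]
    nlinarith

/-- Paley–Zygmund for Rademacher sums, in counting form. -/
theorem two_pow_le_card_signed_sum_gt (a : ℕ → ℝ) (n : ℕ) {c : ℝ}
    (h : 4 * c ^ 2 < ∑ i ∈ Finset.range n, a i ^ 2) :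
    (2 : ℝ) ^ n ≤ 8 * ((Finset.range n).powerset.filter fun t =>
      c < |∑ i ∈ Finset.range n, if i ∈ t then -a i else a i|).card := by
  set Z : Finset ℕ → ℝ := fun t => ∑ i ∈ Finset.range n, if i ∈ t then -a i else a i with hZ
  set Q := ∑ i ∈ Finset.range n, a i ^ 2
  have hQ : 0 < Q := by nlinarith
  have h2 : ∑ t ∈ (Finset.range n).powerset, Z t ^ 2 = 2 ^ n * Q := sum_powerset_signed_sq a n
  have h4 : ∑ t ∈ (Finset.range n).powerset, Z t ^ 4 ≤ 3 * 2 ^ n * Q ^ 2 :=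
    sum_powerset_signed_pow_four_le a n
  set G := (Finset.range n).powerset.filter fun t => c < |Z t|
  have hsplit : ∑ t ∈ (Finset.range n).powerset, Z t ^ 2 ≤ 2 ^ n * c ^ 2 + ∑ t ∈ G, Z t ^ 2 := by
    rw [Finset.sum_filter]
    have : (2 : ℝ) ^ n * c ^ 2 = ∑ t ∈ (Finset.range n).powerset, c ^ 2 := by simp
    rw [this, ← Finset.sum_add_distrib]
    refine Finset.sum_le_sum fun t _ => ?_
    split_ifs with ht
    · nlinarith [sq_nonneg c]
    · rw [add_zero, ← sq_abs]
      exact pow_le_pow_left₀ (abs_nonneg _) (not_lt.1 ht) 2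
  have hcs : (∑ t ∈ G, Z t ^ 2) ^ 2 ≤ G.card * (3 * 2 ^ n * Q ^ 2) := by
    refine sq_sum_le_card_mul_sum_sq.trans ?_
    gcongr
    refine le_trans ?_ h4
    have h24 : ∀ t, (Z t ^ 2) ^ 2 = Z t ^ 4 := fun t => by ring
    simp only [h24]
    exact Finset.sum_le_sum_of_subset_of_nonneg (Finset.filter_subset _ _)
      fun t _ _ => Even.pow_nonneg (by decide) _
  have hp : (0 : ℝ) < 2 ^ n := by positivity
  have hlow : 3 / 4 * (2 ^ n * Q) ≤ ∑ t ∈ G, Z t ^ 2 := by nlinarith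
  have h3 : (3 / 4 * (2 ^ n * Q)) ^ 2 ≤ G.card * (3 * 2 ^ n * Q ^ 2) :=
    (pow_le_pow_left₀ (by positivity) hlow 2).trans hcs
  have hpos : (0 : ℝ) < 2 ^ n * Q ^ 2 := by positivity
  have h5 : (2 ^ n * Q ^ 2) * (9 / 16 * 2 ^ n) ≤ (2 ^ n * Q ^ 2) * (3 * G.card) := by nlinarith
  have h6 := le_of_mul_le_mul_left h5 hpos
  linarith

theorem exists_perm_mapsTo_of_card_le {N M : ℕ} {A : Finset ℕ} (hA : A ⊆ Finset.range N)
    (hM : M ≤ A.card) :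
    ∃ e : Equiv.Perm ℕ, (∀ n, N ≤ n → e n = n) ∧ ∀ i < M, e i ∈ A := by
  induction M with
  | zero => exact ⟨1, by simp, by simp⟩
  | succ M ih =>
    obtain ⟨e, he, heA⟩ := ih (by omega)
    obtain ⟨a, haA, ha⟩ : ∃ a ∈ A, a ∉ (Finset.range M).image e :=
      Finset.exists_mem_notMem_of_card_lt_card
        (lt_of_le_of_lt Finset.card_image_le (by simpa using hM))
    have haN : a < N := Finset.mem_range.1 (hA haA)
    have hMN : M < N := by
      have := Finset.card_le_card hA
      rw [Finset.card_range] at this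
      omega
    have heM : e M < N := by
      by_contra h
      have := e.injective (he _ (not_lt.1 h))
      omega
    refine ⟨e.trans (Equiv.swap a (e M)), fun n hn => ?_, fun i hi => ?_⟩
    · rw [Equiv.trans_apply, he n hn, Equiv.swap_apply_of_ne_of_ne] <;> omega
    · rcases Nat.lt_succ_iff_lt_or_eq.1 hi with h | rfl
      · rw [Equiv.trans_apply, Equiv.swap_apply_of_ne_of_ne]
        · exact heA i h
        · rintro rfl
          exact ha (Finset.mem_image_of_mem _ (Finset.mem_range.2 h))
        · exact fun h' => h.ne (e.injective h')
      · simpa using haA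

/-- The map exchanging `i` and `N + i` for every `i ∈ t` with `i < N`. -/
def blockSwapFun (N : ℕ) (t : Finset ℕ) (n : ℕ) : ℕ :=
  if n < N then (if n ∈ t then N + n else n)
  else if n < N + N ∧ n - N ∈ t then n - N else n

theorem blockSwapFun_involutive (N : ℕ) (t : Finset ℕ) :
    Function.Involutive (blockSwapFun N t) := by
  intro n
  unfold blockSwapFun
  by_cases h1 : n < N
  · by_cases h2 : n ∈ t <;> simp [h1, h2]
  · by_cases h2 : n < N + N ∧ n - N ∈ t
    · have h3 : n - N < N := by omega
      have h4 : N + (n - N) = n := by omega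
      simp only [h1, h2, h3, h4, if_true, if_false, and_self]
    · simp only [h1, h2, if_false]

/-- The permutation exchanging `i` and `N + i` for every `i ∈ t` with `i < N`. -/
def blockSwap (N : ℕ) (t : Finset ℕ) : Equiv.Perm ℕ :=
  (blockSwapFun_involutive N t).toPerm

theorem blockSwap_left {N i : ℕ} (t : Finset ℕ) (hi : i < N) :
    blockSwap N t i = if i ∈ t then N + i else i := by
  rw [blockSwap, Function.Involutive.coe_toPerm]
  simp [blockSwapFun, hi]

theorem blockSwap_right {N i : ℕ} (t : Finset ℕ) (hi : i < N) :
    blockSwap N t (N + i) = if i ∈ t then i else N + i := by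
  rw [blockSwap, Function.Involutive.coe_toPerm]
  simp [blockSwapFun, hi]

theorem blockSwap_of_le {N n : ℕ} (t : Finset ℕ) (hn : N + N ≤ n) : blockSwap N t n = n := by
  have h1 : ¬ n < N := by omega
  have h2 : ¬ n < N + N := by omega
  rw [blockSwap, Function.Involutive.coe_toPerm]
  simp [blockSwapFun, h1, h2]

/-- Invariance of a law on `ℕ → ℝ` under permutations of finitely many coordinates. -/
def IsExchangeableLaw (ν : Measure (ℕ → ℝ)) : Prop :=
  ∀ e : Equiv.Perm ℕ, {n | e n ≠ n}.Finite → ν.map (fun x n => x (e n)) = ν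

namespace IsExchangeableLaw

variable {ν : Measure (ℕ → ℝ)}

theorem measure_comp_perm (hν : IsExchangeableLaw ν) {e : Equiv.Perm ℕ} {L : ℕ}
    (he : ∀ n, L ≤ n → e n = n) {E : Set (ℕ → ℝ)} (hE : MeasurableSet E) :
    ν {x | (fun n => x (e n)) ∈ E} = ν E := by
  have hfin : {n | e n ≠ n}.Finite :=
    (Set.finite_lt_nat L).subset fun n hn => not_le.1 fun h => hn (he n h)
  conv_rhs => rw [← hν e hfin]
  rw [Measure.map_apply (by fun_prop) hE]
  rfl

theorem measure_sum_sq_sub_gt_le (hν : IsExchangeableLaw ν) (N : ℕ) (c : ℝ) :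
    ν {x | 4 * c ^ 2 < ∑ i ∈ Finset.range N, (x i - x (N + i)) ^ 2}
      ≤ 8 * ν {x | c < |∑ i ∈ Finset.range N, (x i - x (N + i))|} := by
  classical
  set E : Set (ℕ → ℝ) := {x | c < |∑ i ∈ Finset.range N, (x i - x (N + i))|} with hEdef
  have hE : MeasurableSet E := measurableSet_lt (by fun_prop) (by fun_prop)
  set Es : Finset ℕ → Set (ℕ → ℝ) := fun t =>
    {x | c < |∑ i ∈ Finset.range N, if i ∈ t then -(x i - x (N + i)) else x i - x (N + i)|}
    with hEs
  have hEst : ∀ t, Es t = {x | (fun n => x (blockSwap N t n)) ∈ E} := by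
    intro t
    ext x
    simp only [hEs, hEdef, Set.mem_ofPred_eq]
    rw [Finset.sum_congr rfl]
    intro i hi
    rw [Finset.mem_range] at hi
    rw [blockSwap_left t hi, blockSwap_right t hi]
    split_ifs <;> ring
  have hν_Es : ∀ t, ν (Es t) = ν E := fun t => by
    rw [hEst]
    exact hν.measure_comp_perm (fun n hn => blockSwap_of_le t hn) hE
  have hmEs : ∀ t, MeasurableSet (Es t) := fun t => by
    rw [hEst]
    have hcomp : Measurable fun (x : ℕ → ℝ) n => x (blockSwap N t n) := by fun_prop
    exact hcomp hE
  set f : (ℕ → ℝ) → ENNReal := fun x =>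
    ∑ t ∈ (Finset.range N).powerset, (Es t).indicator 1 x with hf
  have hfint : ∫⁻ x, f x ∂ν = 2 ^ N * ν E := by
    rw [hf, lintegral_finsetSum _ fun t _ => measurable_one.indicator (hmEs t)]
    simp [hmEs, hν_Es]
  have hfm : Measurable f :=
    Finset.measurable_fun_sum _ fun t _ => measurable_one.indicator (hmEs t)
  have hsub : {x : ℕ → ℝ | 4 * c ^ 2 < ∑ i ∈ Finset.range N, (x i - x (N + i)) ^ 2}
      ⊆ {x | (2 : ENNReal) ^ N ≤ 8 * f x} := by
    intro x hx
    have h := two_pow_le_card_signed_sum_gt (fun i => x i - x (N + i)) N hx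
    have hfx : f x = (((Finset.range N).powerset.filter fun t => x ∈ Es t).card : ENNReal) := by
      simp [hf, Set.indicator_apply, Finset.sum_boole]
    rw [Set.mem_ofPred_eq, hfx]
    exact_mod_cast h
  have h1 := mul_meas_ge_le_lintegral (μ := ν) (hfm.const_mul 8) (2 ^ N)
  rw [lintegral_const_mul _ hfm, hfint, mul_left_comm] at h1
  exact (measure_mono hsub).trans
    ((ENNReal.mul_le_mul_iff_right (by positivity) (by finiteness)).1 h1)

theorem measure_sum_range_sq_gt_le (hν : IsExchangeableLaw ν) (N M : ℕ) (K R : ℝ) :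
    ν {x | M ≤ ((Finset.range N).filter fun i => |x (N + i)| ≤ K).card ∧
        R < ∑ i ∈ Finset.range M, x i ^ 2}
      ≤ ν {x | R < ∑ i ∈ (Finset.range N).filter fun i => |x (N + i)| ≤ K, x i ^ 2} := by
  classical
  set A : (ℕ → ℝ) → Finset ℕ := fun x => (Finset.range N).filter fun i => |x (N + i)| ≤ K with hA
  have hmA : ∀ s, MeasurableSet (A ⁻¹' {s}) := by
    intro s
    have : A ⁻¹' {s} = {x | ∀ i, i ∈ s ↔ (i < N ∧ |x (N + i)| ≤ K)} := by
      ext x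
      simp only [hA, Set.mem_preimage, Set.mem_singleton_iff, Finset.ext_iff, Finset.mem_filter,
        Finset.mem_range, Set.mem_ofPred_eq]
      exact forall_congr' fun i => Iff.comm
    rw [this, Set.ofPred_forall]
    refine MeasurableSet.iInter fun i => ?_
    have : MeasurableSet {x : ℕ → ℝ | |x (N + i)| ≤ K} :=
      measurableSet_le (by fun_prop) (by fun_prop)
    by_cases h1 : i ∈ s <;> by_cases h2 : i < N <;> simp only [h1, h2, true_iff, false_iff,
      true_and, false_and]
    exacts [this, MeasurableSet.const _, this.compl, MeasurableSet.const _]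
  have hsum : ∀ E, ν E = ∑ s ∈ (Finset.range N).powerset, ν (A ⁻¹' {s} ∩ E) := by
    intro E
    have h := sum_measure_preimage_singleton (μ := ν.restrict E) (Finset.range N).powerset
      (f := A) fun s _ => hmA s
    have huniv : A ⁻¹' ↑((Finset.range N).powerset) = Set.univ :=
      Set.eq_univ_of_forall fun x =>
        show A x ∈ ↑(Finset.range N).powerset from
          Finset.mem_powerset.2 (Finset.filter_subset _ _)
    rw [huniv, Measure.restrict_apply_univ] at h
    rw [← h]
    exact Finset.sum_congr rfl fun s _ => Measure.restrict_apply (hmA s)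
  rw [hsum, hsum {x | R < ∑ i ∈ A x, x i ^ 2}]
  refine Finset.sum_le_sum fun s hs => ?_
  rw [Finset.mem_powerset] at hs
  by_cases hM : M ≤ s.card
  swap
  · refine (measure_mono_null ?_ measure_empty).le.trans zero_le
    rintro x ⟨rfl, h, -⟩
    exact hM h
  obtain ⟨e, he, hes⟩ := exists_perm_mapsTo_of_card_le hs hM
  have hB : MeasurableSet (A ⁻¹' {s} ∩ {x | R < ∑ i ∈ Finset.range M, x i ^ 2}) :=
    (hmA s).inter (measurableSet_lt (by fun_prop) (by fun_prop))
  calc ν (A ⁻¹' {s} ∩ {x | M ≤ (A x).card ∧ R < ∑ i ∈ Finset.range M, x i ^ 2})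
      ≤ ν (A ⁻¹' {s} ∩ {x | R < ∑ i ∈ Finset.range M, x i ^ 2}) :=
        measure_mono fun x hx => ⟨hx.1, hx.2.2⟩
    _ = _ := (hν.measure_comp_perm he hB).symm
    _ ≤ _ := measure_mono ?_
  rintro x ⟨hx1, hx2⟩
  have hAx : A (fun n => x (e n)) = A x :=
    Finset.filter_congr fun i _ => by simp only [he (N + i) (by omega)]
  rw [Set.mem_preimage, hAx, Set.mem_singleton_iff] at hx1
  refine ⟨hx1, show R < ∑ i ∈ A x, x i ^ 2 from lt_of_lt_of_le
    (show R < ∑ i ∈ Finset.range M, x (e i) ^ 2 from hx2) ?_⟩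
  rw [hx1, ← Finset.sum_image (f := fun i => x i ^ 2) e.injective.injOn]
  exact Finset.sum_le_sum_of_subset_of_nonneg
    (Finset.image_subset_iff.2 fun i hi => hes i (Finset.mem_range.1 hi))
    fun i _ _ => sq_nonneg _

theorem measure_abs_coord_gt (hν : IsExchangeableLaw ν) (K : ℝ) (j : ℕ) :
    ν {x | K < |x j|} = ν {x | K < |x 0|} := by
  have hE : MeasurableSet {x : ℕ → ℝ | K < |x 0|} := measurableSet_lt (by fun_prop) (by fun_prop)
  rw [← hν.measure_comp_perm (e := Equiv.swap 0 j) (L := j + 1) (fun n hn =>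
    Equiv.swap_apply_of_ne_of_ne (by omega) (by omega)) hE]
  simp

theorem measure_card_filter_lt_le (hν : IsExchangeableLaw ν) {M : ℕ} (hM : 0 < M) (K : ℝ) :
    ν {x | ((Finset.range (2 * M)).filter fun i => |x (2 * M + i)| ≤ K).card < M}
      ≤ 2 * ν {x | K < |x 0|} := by
  classical
  have hE : ∀ i, MeasurableSet {x : ℕ → ℝ | K < |x (2 * M + i)|} := fun i =>
    measurableSet_lt (by fun_prop) (by fun_prop)
  set f : (ℕ → ℝ) → ENNReal := fun x =>
    ∑ i ∈ Finset.range (2 * M), {x : ℕ → ℝ | K < |x (2 * M + i)|}.indicator 1 x with hf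
  have hfm : Measurable f :=
    Finset.measurable_fun_sum _ fun i _ => measurable_one.indicator (hE i)
  have hfint : ∫⁻ x, f x ∂ν = M * (2 * ν {x | K < |x 0|}) := by
    rw [hf, lintegral_finsetSum _ fun i _ => measurable_one.indicator (hE i)]
    simp only [lintegral_indicator_one (hE _), hν.measure_abs_coord_gt, Finset.sum_const,
      Finset.card_range, nsmul_eq_mul]
    push_cast
    ring
  have hsub : {x : ℕ → ℝ |
      ((Finset.range (2 * M)).filter fun i => |x (2 * M + i)| ≤ K).card < M}
      ⊆ {x | (M : ENNReal) ≤ f x} := by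
    intro x hx
    have hcard := Finset.card_filter_add_card_filter_not (s := Finset.range (2 * M))
      (fun i => |x (2 * M + i)| ≤ K)
    have hfx : f x = (((Finset.range (2 * M)).filter fun i => ¬ |x (2 * M + i)| ≤ K).card
        : ENNReal) := by
      simp [hf, Set.indicator_apply, Finset.sum_boole]
    rw [Set.mem_ofPred_eq] at hx ⊢
    rw [hfx]
    rw [Finset.card_range] at hcard
    exact_mod_cast (by omega)
  have h1 := mul_meas_ge_le_lintegral (μ := ν) hfm M
  rw [hfint] at h1
  exact (measure_mono hsub).trans
    ((ENNReal.mul_le_mul_iff_right (by positivity) (by finiteness)).1 h1)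

theorem measure_abs_sum_sub_gt_le (hν : IsExchangeableLaw ν) {N : ℕ} (hN : 0 < N) (ε : ℝ)
    {H : (ℕ → ℝ) → ℝ} (hH : Measurable H)
    (hHinv : ∀ e : Equiv.Perm ℕ, (∀ n, N + N ≤ n → e n = n) → ∀ x, H (fun n => x (e n)) = H x) :
    ν {x | 2 * ε * N < |∑ i ∈ Finset.range N, (x i - x (N + i))|}
      ≤ 2 * ν {x | ε < |(N : ℝ)⁻¹ * ∑ i ∈ Finset.range N, x i - H x|} := by
  set E : Set (ℕ → ℝ) := {x | ε < |(N : ℝ)⁻¹ * ∑ i ∈ Finset.range N, x i - H x|} with hEdef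
  have hE : MeasurableSet E := measurableSet_lt (by fun_prop) (by fun_prop)
  set e := blockSwap N (Finset.range N)
  have he : ∀ n, N + N ≤ n → e n = n := fun n hn => blockSwap_of_le _ hn
  have hsub : {x : ℕ → ℝ | 2 * ε * N < |∑ i ∈ Finset.range N, (x i - x (N + i))|}
      ⊆ E ∪ {x | (fun n => x (e n)) ∈ E} := by
    intro x hx
    by_contra hcon
    have h1 : x ∉ E := fun h => hcon (Or.inl h)
    have h2 : (fun n => x (e n)) ∉ E := fun h => hcon (Or.inr h)
    rw [hEdef, Set.mem_ofPred_eq, not_lt] at h1 h2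
    rw [Set.mem_ofPred_eq] at hx
    have hsum : ∑ i ∈ Finset.range N, x (e i) = ∑ i ∈ Finset.range N, x (N + i) :=
      Finset.sum_congr rfl fun i hi => by
        simp only [e, blockSwap_left _ (Finset.mem_range.1 hi), hi, if_true]
    rw [hHinv e he, hsum] at h2
    have hNr : (0 : ℝ) < N := by exact_mod_cast hN
    have h3 : |(N : ℝ)⁻¹ * ∑ i ∈ Finset.range N, (x i - x (N + i))| ≤ 2 * ε := by
      rw [Finset.sum_sub_distrib, mul_sub]
      rw [abs_le] at *
      constructor <;> linarith
    rw [abs_mul, abs_of_pos (inv_pos.2 hNr), inv_mul_le_iff₀ hNr] at h3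
    linarith
  calc _ ≤ _ := measure_mono hsub
    _ ≤ _ := measure_union_le _ _
    _ = _ := by rw [hν.measure_comp_perm he hE, two_mul]

theorem measure_sum_range_sq_gt_le_add (hν : IsExchangeableLaw ν) {M : ℕ} (hM : 0 < M) (K ε : ℝ)
    {H : (ℕ → ℝ) → ℝ} (hH : Measurable H)
    (hHinv : ∀ e : Equiv.Perm ℕ, (∀ n, 2 * M + 2 * M ≤ n → e n = n) →
      ∀ x, H (fun n => x (e n)) = H x) :
    ν {x | 128 * ε ^ 2 * M ^ 2 + 4 * K ^ 2 * M < ∑ i ∈ Finset.range M, x i ^ 2}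
      ≤ 2 * ν {x | K < |x 0|} + 16 * ν {x | ε <
        |((2 * M : ℕ) : ℝ)⁻¹ * ∑ i ∈ Finset.range (2 * M), x i - H x|} := by
  classical
  set R : ℝ := 128 * ε ^ 2 * M ^ 2 + 4 * K ^ 2 * M with hR
  have hsub : {x : ℕ → ℝ | R < ∑ i ∈ Finset.range M, x i ^ 2} ⊆
      {x | ((Finset.range (2 * M)).filter fun i => |x (2 * M + i)| ≤ K).card < M} ∪
      {x | M ≤ ((Finset.range (2 * M)).filter fun i => |x (2 * M + i)| ≤ K).card ∧
        R < ∑ i ∈ Finset.range M, x i ^ 2} := fun x hx =>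
    (lt_or_ge _ M).imp id fun h => ⟨h, hx⟩
  have hsub2 : {x : ℕ → ℝ |
        R < ∑ i ∈ (Finset.range (2 * M)).filter fun i => |x (2 * M + i)| ≤ K, x i ^ 2} ⊆
      {x | 4 * (2 * ε * (2 * M : ℕ)) ^ 2
        < ∑ i ∈ Finset.range (2 * M), (x i - x (2 * M + i)) ^ 2} := by
    intro x hx
    rw [Set.mem_ofPred_eq] at hx ⊢
    have h1 : ∑ i ∈ (Finset.range (2 * M)).filter fun i => |x (2 * M + i)| ≤ K, x i ^ 2
        ≤ ∑ i ∈ Finset.range (2 * M), (2 * (x i - x (2 * M + i)) ^ 2 + 2 * K ^ 2) := by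
      rw [Finset.sum_filter]
      refine Finset.sum_le_sum fun i _ => ?_
      split_ifs with h
      · have : x (2 * M + i) ^ 2 ≤ K ^ 2 := by
          rw [← sq_abs]
          exact pow_le_pow_left₀ (abs_nonneg _) h 2
        nlinarith [sq_nonneg (x i - 2 * x (2 * M + i))]
      · positivity
    rw [Finset.sum_add_distrib, ← Finset.mul_sum] at h1
    simp only [Finset.sum_const, Finset.card_range, nsmul_eq_mul] at h1
    push_cast at h1 ⊢
    nlinarith
  calc ν {x | R < ∑ i ∈ Finset.range M, x i ^ 2}
      ≤ _ := (measure_mono hsub).trans (measure_union_le _ _)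
    _ ≤ _ := add_le_add (hν.measure_card_filter_lt_le hM K)
        ((hν.measure_sum_range_sq_gt_le (2 * M) M K R).trans <| (measure_mono hsub2).trans <|
          (hν.measure_sum_sq_sub_gt_le (2 * M) _).trans <| mul_le_mul_right
            (hν.measure_abs_sum_sub_gt_le (N := 2 * M) (by omega) ε hH hHinv) 8)
    _ = _ := by
      rw [← mul_assoc]
      norm_num

end IsExchangeableLaw

theorem exists_measure_abs_gt_le {Ω : Type*} [MeasurableSpace Ω] (μ : Measure Ω)
    [IsFiniteMeasure μ] {f : Ω → ℝ} (hf : Measurable f) {η : ENNReal} (hη : 0 < η) :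
    ∃ K : ℝ, μ {ω | K < |f ω|} ≤ η := by
  have h := tendsto_measure_iInter_atTop (μ := μ) (s := fun n : ℕ => {ω | (n : ℝ) < |f ω|})
    (fun n => (measurableSet_lt (by fun_prop) (by fun_prop)).nullMeasurableSet)
    (fun m n hmn ω (hω : (n : ℝ) < |f ω|) =>
      show (m : ℝ) < |f ω| from lt_of_le_of_lt (Nat.cast_le.2 hmn) hω) ⟨0, measure_ne_top _ _⟩
  have hempty : ⋂ n : ℕ, {ω | (n : ℝ) < |f ω|} = ∅ := by
    refine Set.eq_empty_of_forall_notMem fun ω hω => ?_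
    obtain ⟨n, hn⟩ := exists_nat_gt |f ω|
    exact lt_asymm hn (Set.mem_iInter.1 hω n)
  rw [hempty, measure_empty] at h
  obtain ⟨n, hn⟩ := (h.eventually (ge_mem_nhds hη)).exists
  exact ⟨n, hn⟩

/-- A tail-measurable function factors measurably through every shift of the sequence. -/
theorem exists_eq_comp_shift_of_measurable_tailSigma {Ω : Type*} {g : ℕ → Ω → ℝ} {f : Ω → ℝ}
    (hf : Measurable[tailSigma g] f) (n : ℕ) :
    ∃ h : (ℕ → ℝ) → ℝ, Measurable h ∧ f = fun ω => h fun k => g (n + k) ω := by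
  have hle : tailSigma g ≤ MeasurableSpace.comap (fun ω k => g (n + k) ω) MeasurableSpace.pi := by
    refine (iInf_le _ n).trans (iSup₂_le fun m hm => ?_)
    obtain ⟨k, rfl⟩ := Nat.exists_eq_add_of_le hm
    have : g (n + k) = (fun x : ℕ → ℝ => x k) ∘ fun ω k => g (n + k) ω := rfl
    rw [this, ← MeasurableSpace.comap_comp]
    exact MeasurableSpace.comap_mono (measurable_pi_apply k).comap_le
  obtain ⟨h, hh, rfl⟩ := (hf.mono hle le_rfl).exists_eq_measurable_comp
  exact ⟨h, hh, rfl⟩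

theorem measure_sum_range_sq_gt_le_of_exchangeable {Ω : Type*} [MeasurableSpace Ω] (μ : Measure Ω)
    {g : ℕ → Ω → ℝ} (hm : ∀ n, Measurable (g n))
    (hexch : ∀ e : Equiv.Perm ℕ, {n | e n ≠ n}.Finite →
      Measure.map (fun ω => fun n : ℕ => g (e n) ω) μ
        = Measure.map (fun ω => fun n : ℕ => g n ω) μ)
    {f : Ω → ℝ} (hf : Measurable[tailSigma g] f) {M : ℕ} (hM : 0 < M) (K ε : ℝ) :
    μ {ω | 128 * ε ^ 2 * M ^ 2 + 4 * K ^ 2 * M < ∑ i ∈ Finset.range M, g i ω ^ 2}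
      ≤ 2 * μ {ω | K < |g 0 ω|} + 16 * μ {ω | ε <
        |((2 * M : ℕ) : ℝ)⁻¹ * ∑ i ∈ Finset.range (2 * M), g i ω - f ω|} := by
  have hG : Measurable fun ω n => g n ω := measurable_pi_lambda _ hm
  have hν : IsExchangeableLaw (μ.map fun ω n => g n ω) := fun e he => by
    rw [Measure.map_map (by fun_prop) hG, ← hexch e he]
    rfl
  obtain ⟨h, hh, rfl⟩ := exists_eq_comp_shift_of_measurable_tailSigma hf (2 * M + 2 * M)
  have key := hν.measure_sum_range_sq_gt_le_add hM K ε
    (H := fun x => h fun k => x (2 * M + 2 * M + k)) (by fun_prop) fun e he x => by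
      simp only [he _ (Nat.le_add_right _ _)]
  rwa [Measure.map_apply hG (measurableSet_lt (by fun_prop) (by fun_prop)),
    Measure.map_apply hG (measurableSet_lt (by fun_prop) (by fun_prop)),
    Measure.map_apply hG (measurableSet_lt (by fun_prop) (by fun_prop))] at key

/-- If the exchangeable sequence (g_n) satisfies the WLLN with T*-measurable
correctors D_N, |D_N| ≤ N a.s., then D_N/√N → 0 in probability. -/
theorem stmt_19 {Ω : Type*} [MeasurableSpace Ω] (μ : Measure Ω) [IsProbabilityMeasure μ]
    (g : ℕ → Ω → ℝ) (hm : ∀ n, Measurable (g n))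
    (hexch : ∀ e : Equiv.Perm ℕ, {n | e n ≠ n}.Finite →
      Measure.map (fun ω => fun n : ℕ => g (e n) ω) μ
        = Measure.map (fun ω => fun n : ℕ => g n ω) μ)
    (D : ℕ → Ω → ℝ)
    (hDmeas : ∀ N : ℕ, Measurable[tailSigma g] (D N))
    (hDbdd : ∀ᵐ ω ∂μ, ∀ N : ℕ, |D N ω| ≤ (N : ℝ))
    (hWLLN : ∀ ε > (0:ℝ), Tendsto (fun N : ℕ =>
      μ {ω | ε < |(N : ℝ)⁻¹ * ∑ n ∈ Finset.range N, g n ω - D N ω|}) atTop (nhds 0)) :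
    TendstoInMeasure μ (fun (N : ℕ) (ω : Ω) => D N ω / Real.sqrt N) atTop 0 := by
  rw [tendstoInMeasure_iff_norm]
  intro δ hδ
  rw [ENNReal.tendsto_nhds_zero]
  intro η hη
  have hη' : 0 < η / 32 := ENNReal.div_pos hη.ne' (by finiteness)
  obtain ⟨K, hK⟩ := exists_measure_abs_gt_le μ (hm 0) hη'
  have hdouble : Tendsto (fun M : ℕ => 2 * M) atTop atTop :=
    tendsto_id.const_mul_atTop' two_pos
  have hlarge : ∀ᶠ M : ℕ in atTop, (2 + 8 * K ^ 2) / (δ ^ 2 / 2) < (M : ℝ) :=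
    tendsto_natCast_atTop_atTop.eventually (eventually_gt_atTop _)
  filter_upwards [ENNReal.tendsto_nhds_zero.1 (hWLLN 1 one_pos) _ hη',
    ENNReal.tendsto_nhds_zero.1 ((hWLLN (δ / 32) (by positivity)).comp hdouble) _ hη',
    hlarge, eventually_gt_atTop 0] with M h1 h2 h3 hM
  have hMr : (0 : ℝ) < M := by exact_mod_cast hM
  have hsub : {ω | δ ≤ ‖D M ω / Real.sqrt M - (0 : Ω → ℝ) ω‖} ⊆
      {ω | 1 < |(M : ℝ)⁻¹ * ∑ n ∈ Finset.range M, g n ω - D M ω|} ∪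
      {ω | 128 * (δ / 32) ^ 2 * M ^ 2 + 4 * K ^ 2 * M < ∑ i ∈ Finset.range M, g i ω ^ 2} := by
    intro ω hω
    by_contra hcon
    rw [Set.mem_union, not_or, Set.mem_ofPred_eq, Set.mem_ofPred_eq, not_lt, not_lt] at hcon
    obtain ⟨hc1, hc2⟩ := hcon
    rw [Set.mem_ofPred_eq] at hω
    rw [Pi.zero_apply, sub_zero, Real.norm_eq_abs, abs_div,
      abs_of_nonneg (Real.sqrt_nonneg _), le_div_iff₀ (Real.sqrt_pos.2 hMr)] at hω
    have hsq : δ ^ 2 * M ≤ D M ω ^ 2 := by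
      have := pow_le_pow_left₀ (by positivity) hω 2
      rwa [mul_pow, Real.sq_sqrt hMr.le, sq_abs] at this
    set A := (M : ℝ)⁻¹ * ∑ n ∈ Finset.range M, g n ω with hA
    have hAsq : A ^ 2 ≤ 128 * (δ / 32) ^ 2 * M + 4 * K ^ 2 := by
      have hcs := sq_sum_le_card_mul_sum_sq (s := Finset.range M) (f := fun n => g n ω)
      rw [Finset.card_range] at hcs
      rw [hA, mul_pow, inv_pow, inv_mul_le_iff₀ (by positivity)]
      calc _ ≤ _ := hcs
        _ ≤ _ := mul_le_mul_of_nonneg_left hc2 hMr.le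
        _ = _ := by ring
    have hdiff : (A - D M ω) ^ 2 ≤ 1 := by
      rw [← sq_abs]
      exact pow_le_one₀ (abs_nonneg _) hc1
    rw [div_lt_iff₀ (by positivity)] at h3
    have hfin : D M ω ^ 2 ≤ 2 * A ^ 2 + 2 * (A - D M ω) ^ 2 := by
      nlinarith [sq_nonneg (2 * A - D M ω)]
    nlinarith [mul_pos (pow_pos hδ 2) hMr]
  calc μ {ω | δ ≤ ‖D M ω / Real.sqrt M - (0 : Ω → ℝ) ω‖}
      ≤ _ := (measure_mono hsub).trans (measure_union_le _ _)
    _ ≤ η / 32 + (2 * (η / 32) + 16 * (η / 32)) := by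
      refine add_le_add h1 ((measure_sum_range_sq_gt_le_of_exchangeable μ hm hexch
        (hDmeas (2 * M)) hM K (δ / 32)).trans ?_)
      gcongr
      exact h2
    _ = 19 * (η / 32) := by ring
    _ ≤ 32 * (η / 32) := by
      gcongr
      norm_num
    _ = η := ENNReal.mul_div_cancel (by norm_num) (by finiteness)
end
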